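/- arXiv:1202.1598 — 2 statements merged into one kernel-verified Lean document; each statement's English description precedes it below -/
import Mathlib

section
/- Let ψ ∈ ℂ^M ⊗ ℂ^N be a unit vector with Schmidt rank r (i.e., r = rank(Tr_B(|ψ⟩⟨ψ|))), and let 1 ≤ k ≤ M. Then there exists a unitary U on ℂ^M such that every eigenvalue of U has multiplicity at most k, at least one eigenvalue of U has multiplicity exactly k, and (U ⊗ I_N)|ψ⟩⟨ψ|(U† ⊗ I_N) = |ψ⟩⟨ψ| (equivalently D(|ψ⟩⟨ψ|,U) = 0), if and only if k ≥ r. -/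
open Matrix Kronecker BigOperators ComplexOrder

noncomputable section

/-- Frobenius (Hilbert–Schmidt) norm of a square complex matrix. -/
def frob {n : Type*} [Fintype n] (A : Matrix n n ℂ) : ℝ :=
  Real.sqrt (Matrix.trace (Aᴴ * A)).re

/-- Conjugation of a bipartite matrix by `U ⊗ I`. -/
def conjA {M N : ℕ} (U : Matrix (Fin M) (Fin M) ℂ)
    (ρ : Matrix (Fin M × Fin N) (Fin M × Fin N) ℂ) :
    Matrix (Fin M × Fin N) (Fin M × Fin N) ℂ :=
  (U ⊗ₖ (1 : Matrix (Fin N) (Fin N) ℂ)) * ρ * (U ⊗ₖ (1 : Matrix (Fin N) (Fin N) ℂ))ᴴ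

/-- The quantity `D(ρ,U) = (1/√2)·‖ρ − (U⊗I) ρ (U⊗I)†‖_F`. -/
def DU {M N : ℕ} (ρ : Matrix (Fin M × Fin N) (Fin M × Fin N) ℂ)
    (U : Matrix (Fin M) (Fin M) ℂ) : ℝ :=
  (1 / Real.sqrt 2) * frob (ρ - conjA U ρ)

/-- A Root-of-Unity (RU) unitary: a unitary whose eigenvalues, with multiplicity,
are exactly the `M` distinct `M`-th roots of unity. -/
def IsRU {M : ℕ} (U : Matrix (Fin M) (Fin M) ℂ) : Prop :=
  ∃ V ∈ Matrix.unitaryGroup (Fin M) ℂ,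
    U = V * Matrix.diagonal (fun k : Fin M =>
      Complex.exp (2 * Real.pi * Complex.I * (((k : ℕ) : ℂ) + 1) / (M : ℂ))) * Vᴴ

/-- The measure `D(ρ)`: infimum of `D(ρ,U)` over RU unitaries `U`. -/
def Dm {M N : ℕ} (ρ : Matrix (Fin M × Fin N) (Fin M × Fin N) ℂ) : ℝ :=
  sInf {d : ℝ | ∃ U, IsRU U ∧ d = DU ρ U}

/-- A bipartite quantum state: positive semidefinite with unit trace. -/
def IsState {M N : ℕ} (ρ : Matrix (Fin M × Fin N) (Fin M × Fin N) ℂ) : Prop :=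
  ρ.PosSemidef ∧ ρ.trace = 1

/-- Partial trace over the second tensor factor. -/
def traceB {M N : ℕ} (ρ : Matrix (Fin M × Fin N) (Fin M × Fin N) ℂ) :
    Matrix (Fin M) (Fin M) ℂ :=
  Matrix.of fun p q => ∑ j : Fin N, ρ (p, j) (q, j)

/-- Rank-one outer product `|v⟩⟨v|`. -/
def outer {α : Type*} (v : α → ℂ) : Matrix α α ℂ :=
  Matrix.of fun i j => v i * (starRingEnd ℂ) (v j)

/-- The Pauli matrices. -/
def pauli : Fin 3 → Matrix (Fin 2) (Fin 2) ℂ :=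
  ![!![0, 1; 1, 0], !![0, -Complex.I; Complex.I, 0], !![1, 0; 0, -1]]


/-- The coefficient matrix of a bipartite vector. -/
def coeffMatrix {M N : ℕ} (ψ : Fin M × Fin N → ℂ) : Matrix (Fin M) (Fin N) ℂ :=
  Matrix.of fun p j => ψ (p, j)

lemma traceB_outer {M N : ℕ} (ψ : Fin M × Fin N → ℂ) :
    traceB (outer ψ) = coeffMatrix ψ * (coeffMatrix ψ)ᴴ := by
  ext p q
  simp [traceB, outer, coeffMatrix, Matrix.mul_apply]

lemma conjA_outer {M N : ℕ} (U : Matrix (Fin M) (Fin M) ℂ) (ψ : Fin M × Fin N → ℂ) :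
    conjA U (outer ψ) = outer fun x => (U * coeffMatrix ψ) x.1 x.2 := by
  have houter : ∀ v : Fin M × Fin N → ℂ, outer v = Matrix.vecMulVec v (star v) := by
    intro v
    ext i j
    simp [outer, Matrix.vecMulVec_apply]
  have hvec : (U ⊗ₖ (1 : Matrix (Fin N) (Fin N) ℂ)) *ᵥ ψ =
      fun x => (U * coeffMatrix ψ) x.1 x.2 := by
    ext ⟨p, j⟩
    simp [Matrix.mulVec, dotProduct, Fintype.sum_prod_type, Matrix.mul_apply, coeffMatrix,
      Matrix.one_apply]
  rw [conjA, houter, houter, Matrix.mul_vecMulVec, Matrix.vecMulVec_mul, ← Matrix.star_mulVec, hvec]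

/-- Vectors with the same outer product are proportional. -/
lemma exists_smul_eq_of_outer_eq {α : Type*} {v w : α → ℂ} (hw : w ≠ 0)
    (h : outer v = outer w) : ∃ c : ℂ, v = c • w := by
  obtain ⟨i, hi⟩ := Function.ne_iff.mp hw
  have hij : ∀ j, v j * (starRingEnd ℂ) (v i) = w j * (starRingEnd ℂ) (w i) :=
    fun j => congrFun (congrFun h j) i
  have hi' : w i ≠ 0 := hi
  have hv : (starRingEnd ℂ) (v i) ≠ 0 := by
    intro h0
    have hii := hij i
    rw [h0, mul_zero] at hii
    simp [hi'] at hii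
  refine ⟨(starRingEnd ℂ) (w i) / (starRingEnd ℂ) (v i), funext fun j => ?_⟩
  simp only [Pi.smul_apply, smul_eq_mul]
  rw [div_mul_eq_mul_div, eq_div_iff hv, hij j, mul_comm]

/-- If `U * A = c • A`, then the column space of `A` lies in the eigenspace of `U` at `c`. -/
lemma rank_le_finrank_eigenspace {m n : Type*} [Fintype m] [DecidableEq m] [Fintype n]
    {U : Matrix m m ℂ} {A : Matrix m n ℂ} {c : ℂ} (h : U * A = c • A) :
    A.rank ≤ Module.finrank ℂ (Module.End.eigenspace (Matrix.toLin' U) c) := by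
  refine Submodule.finrank_mono ?_
  rintro _ ⟨x, rfl⟩
  rw [Module.End.mem_eigenspace_iff]
  simp [Matrix.mulVec_mulVec, h, Matrix.smul_mulVec]

/-- The multiplicity of `μ` in a unitarily diagonalized matrix. -/
lemma finrank_eigenspace_conj_diagonal {m : Type*} [Fintype m] [DecidableEq m]
    {V : Matrix m m ℂ} (hV : V ∈ Matrix.unitaryGroup m ℂ) (d : m → ℂ) (μ : ℂ) :
    Module.finrank ℂ (Module.End.eigenspace
      (Matrix.toLin' (V * Matrix.diagonal d * Vᴴ)) μ) = Fintype.card {i // d i = μ} := by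
  have hVV : V * Vᴴ = 1 := Matrix.mem_unitaryGroup_iff.mp hV
  have hVV' : Vᴴ * V = 1 := Matrix.mem_unitaryGroup_iff'.mp hV
  have hsub : V * Matrix.diagonal d * Vᴴ - μ • 1 =
      V * Matrix.diagonal (fun i => d i - μ) * Vᴴ := by
    have hd : Matrix.diagonal (fun i => d i - μ) = Matrix.diagonal d - μ • 1 := by
      ext i j
      by_cases hij : i = j <;> simp [hij]
    rw [hd, mul_sub, sub_mul, Matrix.mul_smul, mul_one, Matrix.smul_mul, hVV]
  have hrank : (V * Matrix.diagonal d * Vᴴ - μ • 1).rank = Fintype.card {i // d i - μ ≠ 0} := by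
    rw [hsub, Matrix.rank_mul_eq_left_of_isUnit_det,
      Matrix.rank_mul_eq_right_of_isUnit_det, Matrix.rank_diagonal]
    · exact Matrix.isUnit_det_of_left_inverse hVV'
    · exact Matrix.isUnit_det_of_left_inverse hVV
  have hker : Module.End.eigenspace (Matrix.toLin' (V * Matrix.diagonal d * Vᴴ)) μ =
      LinearMap.ker (V * Matrix.diagonal d * Vᴴ - μ • 1).mulVecLin := by
    ext x
    simp [sub_eq_zero]
  have hsum := LinearMap.finrank_range_add_finrank_ker
    (V * Matrix.diagonal d * Vᴴ - μ • 1).mulVecLin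
  rw [← hker, ← Matrix.rank, hrank, Module.finrank_fintype_fun_eq_card] at hsum
  have hcompl := Fintype.card_subtype_compl (fun i => d i = μ)
  have hle := Fintype.card_subtype_le (fun i => d i = μ)
  simp only [sub_ne_zero, ne_eq] at hsum
  omega

/-- There are arbitrarily many distinct phases different from `1`. -/
lemma exists_injective_phases (M : ℕ) :
    ∃ f : Fin M → ℂ, Function.Injective f ∧ (∀ i, f i ≠ 1) ∧ ∀ i, f i * star (f i) = 1 := by
  have hζ := Complex.isPrimitiveRoot_exp (M + 1) (Nat.succ_ne_zero M)
  set ζ := Complex.exp (2 * Real.pi * Complex.I / ((M + 1 : ℕ) : ℂ))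
  have hnorm : ‖ζ‖ = 1 := hζ.norm'_eq_one (Nat.succ_ne_zero M)
  refine ⟨fun i => ζ ^ ((i : ℕ) + 1), fun i j hij => ?_, fun i => ?_, fun i => ?_⟩
  · have := hζ.pow_inj (by omega) (by omega) hij
    exact Fin.ext (by omega)
  · exact hζ.pow_ne_one_of_pos_of_lt (Nat.succ_ne_zero _) (by omega)
  · have h := Complex.mul_conj' (ζ ^ ((i : ℕ) + 1))
    rw [norm_pow, hnorm] at h
    simpa using h

/-- A set of at most `k` coordinates can be fixed by phases whose largest multiplicity is `k`. -/
lemma exists_phases {M k : ℕ} (hk1 : 1 ≤ k) (hkM : k ≤ M) (T : Finset (Fin M))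
    (hT : T.card ≤ k) :
    ∃ d : Fin M → ℂ, (∀ i, d i * star (d i) = 1) ∧ (∀ i ∈ T, d i = 1) ∧
      (∀ μ, Fintype.card {i // d i = μ} ≤ k) ∧ Fintype.card {i // d i = 1} = k := by
  obtain ⟨S, hTS, -, hS⟩ := Finset.exists_subsuperset_card_eq (Finset.subset_univ T) hT
    (by simpa using hkM)
  obtain ⟨f, hinj, hne, hf⟩ := exists_injective_phases M
  have hone : Fintype.card {i // (if i ∈ S then (1 : ℂ) else f i) = 1} = k := by
    rw [Fintype.card_subtype, ← hS]
    congr 1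
    ext i
    by_cases hi : i ∈ S <;> simp [hi, hne]
  refine ⟨fun i => if i ∈ S then 1 else f i, fun i => ?_, fun i hi => if_pos (hTS hi),
    fun μ => ?_, hone⟩
  · by_cases hi : i ∈ S
    · simp [hi]
    · simpa [hi] using hf i
  · by_cases hμ : μ = 1
    · rw [hμ]
      exact hone.le
    · refine le_trans (Fintype.card_le_one_iff.mpr ?_) hk1
      rintro ⟨i, hi⟩ ⟨j, hj⟩
      have hiS : i ∉ S := fun h => hμ (by simpa [h] using hi.symm)
      have hjS : j ∉ S := fun h => hμ (by simpa [h] using hj.symm)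
      simp only [hiS, hjS, if_false] at hi hj
      exact Subtype.ext (hinj (hi.trans hj.symm))

/-- A matrix fixing `A * Aᴴ` fixes `A`. -/
lemma mul_eq_self_of_mul_mul_conjTranspose {m n : Type*} [Fintype m] [DecidableEq m] [Fintype n]
    {U : Matrix m m ℂ} {A : Matrix m n ℂ} (h : U * (A * Aᴴ) = A * Aᴴ) : U * A = A := by
  have h0 : (U * A - A) * (U * A - A)ᴴ = 0 := by
    have hleft : (U * A - A) * Aᴴ = 0 := by
      rw [Matrix.sub_mul, Matrix.mul_assoc, h, sub_self]
    rw [Matrix.conjTranspose_sub, Matrix.conjTranspose_mul, Matrix.mul_sub, ← Matrix.mul_assoc,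
      hleft, Matrix.zero_mul, sub_self]
  exact sub_eq_zero.mp (Matrix.self_mul_conjTranspose_eq_zero.mp h0)

/-- For a unit vector `ψ ∈ ℂ^M ⊗ ℂ^N` of Schmidt rank
`r = rank(Tr_B(|ψ⟩⟨ψ|))` and `1 ≤ k ≤ M`: there is a unitary `U` on `ℂ^M` all of whose
eigenvalue multiplicities are at most `k`, with some eigenvalue of multiplicity exactly
`k`, leaving `|ψ⟩⟨ψ|` invariant, if and only if `k ≥ r`. -/
theorem pure_invariant_unitary_iff_schmidt_rank_le {M N : ℕ}
    (ψ : Fin M × Fin N → ℂ) (hψ : dotProduct (star ψ) ψ = 1)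
    (k : ℕ) (hk1 : 1 ≤ k) (hkM : k ≤ M) :
    (∃ U ∈ Matrix.unitaryGroup (Fin M) ℂ,
        (∀ μ : ℂ, Module.finrank ℂ
          (Module.End.eigenspace (Matrix.toLin' U) μ) ≤ k) ∧
        (∃ μ : ℂ, Module.finrank ℂ
          (Module.End.eigenspace (Matrix.toLin' U) μ) = k) ∧
        conjA U (outer ψ) = outer ψ)
    ↔ (traceB (outer ψ)).rank ≤ k := by
  rw [traceB_outer, Matrix.rank_self_mul_conjTranspose]
  constructor
  · rintro ⟨U, -, hle, -, hinv⟩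
    have hψ0 : ψ ≠ 0 := by
      rintro rfl
      simp at hψ
    rw [conjA_outer] at hinv
    obtain ⟨c, hc⟩ := exists_smul_eq_of_outer_eq hψ0 hinv
    refine (rank_le_finrank_eigenspace (U := U) (c := c) ?_).trans (hle c)
    ext p j
    exact congrFun hc (p, j)
  · intro hr
    have hH := Matrix.isHermitian_mul_conjTranspose_self (coeffMatrix ψ)
    obtain ⟨d, hunit, hT, hle, hk⟩ := exists_phases hk1 hkM
      (Finset.univ.filter fun i => hH.eigenvalues i ≠ 0) (by
        rw [← Fintype.card_subtype, ← hH.rank_eq_card_non_zero_eigs,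
          Matrix.rank_self_mul_conjTranspose]
        exact hr)
    set V := (hH.eigenvectorUnitary : Matrix (Fin M) (Fin M) ℂ)
    have hV : V ∈ Matrix.unitaryGroup (Fin M) ℂ := hH.eigenvectorUnitary.2
    have hVV : V * Vᴴ = 1 := Matrix.mem_unitaryGroup_iff.mp hV
    have hVV' : Vᴴ * V = 1 := Matrix.mem_unitaryGroup_iff'.mp hV
    have hspec : coeffMatrix ψ * (coeffMatrix ψ)ᴴ =
        V * Matrix.diagonal (fun i => (hH.eigenvalues i : ℂ)) * Vᴴ := hH.spectral_theorem
    have hcancel : ∀ a b : Fin M → ℂ,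
        (V * Matrix.diagonal a * Vᴴ) * (V * Matrix.diagonal b * Vᴴ) =
          V * Matrix.diagonal (fun i => a i * b i) * Vᴴ := by
      intro a b
      rw [← Matrix.diagonal_mul_diagonal]
      simp only [Matrix.mul_assoc]
      rw [← Matrix.mul_assoc Vᴴ V, hVV', one_mul]
    refine ⟨V * Matrix.diagonal d * Vᴴ, ?_, fun μ => ?_, ⟨1, ?_⟩, ?_⟩
    · rw [Matrix.mem_unitaryGroup_iff, Matrix.star_eq_conjTranspose]
      have hstar : (V * Matrix.diagonal d * Vᴴ)ᴴ = V * Matrix.diagonal (star d) * Vᴴ := by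
        simp [Matrix.conjTranspose_mul, Matrix.mul_assoc]
      rw [hstar, hcancel]
      simp only [Pi.star_apply, hunit]
      rw [Matrix.diagonal_one, mul_one, hVV]
    · rw [finrank_eigenspace_conj_diagonal hV]
      exact hle μ
    · rw [finrank_eigenspace_conj_diagonal hV]
      exact hk
    · have hfix : (V * Matrix.diagonal d * Vᴴ) * coeffMatrix ψ = coeffMatrix ψ := by
        apply mul_eq_self_of_mul_mul_conjTranspose
        rw [hspec, hcancel]
        congr 3
        ext i
        by_cases hi : hH.eigenvalues i = 0
        · simp [hi]
        · simp [hT i (by simp [hi])]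
      rw [conjA_outer, hfix]
      rfl


end
end

section
/- Let ρ = Σ_{i=1}^n p_i |a_i⟩⟨a_i| ⊗ |b_i⟩⟨b_i| be a separable two-qubit state, where {p_i} is a probability distribution (p_i ≥ 0, Σ_i p_i = 1) and a_i, b_i ∈ ℂ² are unit vectors. Then D(ρ) ≤ 1 − max_i p_i ≤ 1 − 1/n. -/
open Matrix Kronecker BigOperators ComplexOrder

noncomputable section

theorem frob_nonneg {n : Type*} [Fintype n] (A : Matrix n n ℂ) : 0 ≤ frob A :=
  Real.sqrt_nonneg _

section FrobeniusNorm

attribute [local instance] Matrix.frobeniusNormedAddCommGroup Matrix.frobeniusNormedSpace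

theorem frob_eq_norm {n : Type*} [Fintype n] (A : Matrix n n ℂ) : frob A = ‖A‖ := by
  rw [frob, Matrix.frobenius_norm_def, Real.sqrt_eq_rpow]
  congr 1
  simp only [Matrix.trace, Matrix.diag, Matrix.mul_apply, Matrix.conjTranspose_apply,
    Complex.re_sum]
  rw [Finset.sum_comm]
  refine Finset.sum_congr rfl fun i _ => Finset.sum_congr rfl fun j _ => ?_
  rw [Complex.star_def, ← Complex.normSq_eq_conj_mul_self, Complex.ofReal_re,
    Complex.normSq_eq_norm_sq, Real.rpow_two]

theorem frob_sum_smul_le {n ι : Type*} [Fintype n] (s : Finset ι) (p : ι → ℝ)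
    (hp : ∀ i, 0 ≤ p i) (A : ι → Matrix n n ℂ) :
    frob (∑ i ∈ s, p i • A i) ≤ ∑ i ∈ s, p i * frob (A i) := by
  simp only [frob_eq_norm]
  refine (norm_sum_le _ _).trans (Finset.sum_le_sum fun i _ => ?_)
  rw [norm_smul, Real.norm_of_nonneg (hp i)]

end FrobeniusNorm

theorem outer_eq_vecMulVec {α : Type*} (v : α → ℂ) : outer v = vecMulVec v (star v) := rfl

theorem outer_conjTranspose {α : Type*} (v : α → ℂ) : (outer v)ᴴ = outer v := by
  ext i j
  simp [outer, mul_comm]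

theorem outer_smul {α : Type*} (z : ℂ) (hz : star z * z = 1) (v : α → ℂ) :
    outer (z • v) = outer v := by
  ext i j
  simp only [outer, Matrix.of_apply, Pi.smul_apply, smul_eq_mul, map_mul]
  rw [Complex.star_def] at hz
  linear_combination v i * (starRingEnd ℂ) (v j) * hz

theorem trace_outer_mul_outer {α : Type*} [Fintype α] (v w : α → ℂ) :
    (outer v * outer w).trace = (star v ⬝ᵥ w) * (star w ⬝ᵥ v) := by
  rw [outer_eq_vecMulVec, outer_eq_vecMulVec, vecMulVec_mul_vecMulVec, trace_vecMulVec,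
    dotProduct_smul, smul_eq_mul, dotProduct_comm v]

theorem frob_outer_sub_outer_le {α : Type*} [Fintype α] (v w : α → ℂ)
    (hv : star v ⬝ᵥ v = 1) (hw : star w ⬝ᵥ w = 1) :
    frob (outer v - outer w) ≤ √2 := by
  refine Real.sqrt_le_sqrt ?_
  have h : star w ⬝ᵥ v = star (star v ⬝ᵥ w) := by
    rw [star_dotProduct]
  simp only [conjTranspose_sub, outer_conjTranspose, sub_mul, mul_sub, trace_sub,
    trace_outer_mul_outer, hv, hw, h, Complex.star_def, Complex.mul_conj,
    ← Complex.normSq_eq_conj_mul_self]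
  have := Complex.normSq_nonneg (star v ⬝ᵥ w)
  simp only [Complex.sub_re, Complex.mul_re, Complex.one_re, Complex.one_im, Complex.ofReal_re]
  linarith

theorem outer_kronecker_outer {α β : Type*} (v : α → ℂ) (w : β → ℂ) :
    outer v ⊗ₖ outer w = outer fun x : α × β => v x.1 * w x.2 := by
  ext i j
  simp [outer, mul_mul_mul_comm]

theorem mul_outer_mul_conjTranspose {α : Type*} [Fintype α] (U : Matrix α α ℂ) (v : α → ℂ) :
    U * outer v * Uᴴ = outer (U *ᵥ v) := by
  rw [outer_eq_vecMulVec, outer_eq_vecMulVec, mul_vecMulVec, vecMulVec_mul, star_mulVec]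

theorem conjA_kronecker {M N : ℕ} (U A : Matrix (Fin M) (Fin M) ℂ)
    (B : Matrix (Fin N) (Fin N) ℂ) :
    conjA U (A ⊗ₖ B) = (U * A * Uᴴ) ⊗ₖ B := by
  rw [conjA, conjTranspose_kronecker, ← mul_kronecker_mul, ← mul_kronecker_mul]
  simp

theorem conjA_sum_smul {M N : ℕ} {ι : Type*} (s : Finset ι) (U : Matrix (Fin M) (Fin M) ℂ)
    (p : ι → ℝ) (A : ι → Matrix (Fin M × Fin N) (Fin M × Fin N) ℂ) :
    conjA U (∑ i ∈ s, p i • A i) = ∑ i ∈ s, p i • conjA U (A i) := by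
  simp only [conjA, Matrix.mul_sum, Matrix.sum_mul, Matrix.mul_smul, Matrix.smul_mul]

theorem star_dotProduct_prod {α β : Type*} [Fintype α] [Fintype β] (v : α → ℂ) (w : β → ℂ) :
    star (fun x : α × β => v x.1 * w x.2) ⬝ᵥ (fun x : α × β => v x.1 * w x.2)
      = (star v ⬝ᵥ v) * (star w ⬝ᵥ w) := by
  simp only [dotProduct, Fintype.sum_prod_type, Finset.sum_mul_sum, Pi.star_apply, star_mul']
  refine Finset.sum_congr rfl fun i _ => Finset.sum_congr rfl fun j _ => ?_
  ring

theorem star_mulVec_dotProduct_mulVec {α : Type*} [Fintype α] [DecidableEq α] (U : Matrix α α ℂ)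
    (hU : Uᴴ * U = 1) (v : α → ℂ) : star (U *ᵥ v) ⬝ᵥ (U *ᵥ v) = star v ⬝ᵥ v := by
  rw [star_mulVec, dotProduct_mulVec, vecMul_vecMul, hU, vecMul_one]

theorem IsRU.conjTranspose_mul_self {M : ℕ} {U : Matrix (Fin M) (Fin M) ℂ} (hU : IsRU U) :
    Uᴴ * U = 1 := by
  obtain ⟨V, hV, rfl⟩ := hU
  rw [mem_unitaryGroup_iff] at hV
  have hV' : Vᴴ * V = 1 := mul_eq_one_comm.mp hV
  rw [star_eq_conjTranspose] at hV
  set d : Fin M → ℂ := fun k =>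
    Complex.exp (2 * Real.pi * Complex.I * (((k : ℕ) : ℂ) + 1) / (M : ℂ)) with hd
  have hdd : (diagonal d)ᴴ * diagonal d = 1 := by
    rw [diagonal_conjTranspose, diagonal_mul_diagonal, ← diagonal_one]
    congr 1
    funext k
    simp [hd, ← Complex.exp_conj, ← Complex.exp_add, neg_div, Complex.conj_ofNat]
  calc (V * diagonal d * Vᴴ)ᴴ * (V * diagonal d * Vᴴ)
      = V * ((diagonal d)ᴴ * (Vᴴ * V) * diagonal d) * Vᴴ := by
        simp only [conjTranspose_mul, conjTranspose_conjTranspose, Matrix.mul_assoc]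
    _ = 1 := by rw [hV', Matrix.mul_one, hdd, Matrix.mul_one, hV]

/-- Every unit vector of `ℂ²` is a `-1`-eigenvector of some RU unitary. -/
theorem exists_isRU_mulVec_eq_neg (c : Fin 2 → ℂ) (hc : star c ⬝ᵥ c = 1) :
    ∃ U : Matrix (Fin 2) (Fin 2) ℂ, IsRU U ∧ U *ᵥ c = -c := by
  simp only [dotProduct, Fin.sum_univ_two, Pi.star_apply] at hc
  let V : Matrix (Fin 2) (Fin 2) ℂ := !![c 0, -star (c 1); c 1, star (c 0)]
  have hV : Vᴴ * V = 1 := by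
    ext i j
    fin_cases i <;> fin_cases j <;>
      simp only [V, Matrix.mul_apply, Fin.sum_univ_two, conjTranspose_apply, Matrix.of_apply,
        Matrix.cons_val', Matrix.cons_val_zero, Matrix.cons_val_one, Matrix.cons_val_fin_one,
        Fin.zero_eta, Fin.mk_one, Fin.isValue, star_neg, star_star, one_apply_eq, ne_eq,
        zero_ne_one, one_ne_zero, not_false_eq_true, one_apply_ne] <;>
      first | ring1 | linear_combination hc
  refine ⟨_, ⟨V, mem_unitaryGroup_iff'.mpr hV, rfl⟩, ?_⟩
  have hcol : c = V *ᵥ Pi.single 0 1 := by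
    ext i
    fin_cases i <;> simp [V]
  have hexp : Complex.exp (2 * Real.pi * Complex.I * ((((0 : Fin 2) : ℕ) : ℂ) + 1) / ((2 : ℕ) : ℂ))
      = -1 := by
    rw [← Complex.exp_pi_mul_I]
    congr 1
    push_cast
    simp
    ring
  rw [hcol, mulVec_mulVec, Matrix.mul_assoc, hV, Matrix.mul_one, ← mulVec_mulVec,
    diagonal_mulVec_single, hexp, ← mulVec_neg, ← Pi.single_neg]
  simp

theorem DU_nonneg {M N : ℕ} (ρ : Matrix (Fin M × Fin N) (Fin M × Fin N) ℂ)
    (U : Matrix (Fin M) (Fin M) ℂ) : 0 ≤ DU ρ U :=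
  mul_nonneg (by positivity) (frob_nonneg _)

theorem Dm_le_DU {M N : ℕ} (ρ : Matrix (Fin M × Fin N) (Fin M × Fin N) ℂ)
    {U : Matrix (Fin M) (Fin M) ℂ} (hU : IsRU U) : Dm ρ ≤ DU ρ U :=
  csInf_le ⟨0, by rintro _ ⟨W, _, rfl⟩; exact DU_nonneg ρ W⟩ ⟨U, hU, rfl⟩

theorem DU_sum_smul_le {M N : ℕ} {ι : Type*} (s : Finset ι) (p : ι → ℝ) (hp : ∀ i, 0 ≤ p i)
    (A : ι → Matrix (Fin M × Fin N) (Fin M × Fin N) ℂ) (U : Matrix (Fin M) (Fin M) ℂ) :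
    DU (∑ i ∈ s, p i • A i) U ≤ ∑ i ∈ s, p i * DU (A i) U := by
  have h := mul_le_mul_of_nonneg_left (frob_sum_smul_le s p hp fun i => A i - conjA U (A i))
    (by positivity : 0 ≤ 1 / √2)
  simp only [DU, conjA_sum_smul, ← Finset.sum_sub_distrib, ← smul_sub]
  refine h.trans_eq ?_
  rw [Finset.mul_sum]
  exact Finset.sum_congr rfl fun i _ => mul_left_comm _ _ _

theorem DU_outer_kronecker_outer_le_one {M N : ℕ} {U : Matrix (Fin M) (Fin M) ℂ}
    (hU : Uᴴ * U = 1) (v : Fin M → ℂ) (w : Fin N → ℂ)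
    (hv : star v ⬝ᵥ v = 1) (hw : star w ⬝ᵥ w = 1) :
    DU (outer v ⊗ₖ outer w) U ≤ 1 := by
  rw [DU, conjA_kronecker, mul_outer_mul_conjTranspose, outer_kronecker_outer,
    outer_kronecker_outer, one_div, inv_mul_le_iff₀ (by positivity), mul_one]
  apply frob_outer_sub_outer_le
  · rw [star_dotProduct_prod, hv, hw, one_mul]
  · rw [star_dotProduct_prod, star_mulVec_dotProduct_mulVec U hU, hv, hw, one_mul]

theorem DU_outer_kronecker_of_mulVec_eq_neg {M N : ℕ} {U : Matrix (Fin M) (Fin M) ℂ}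
    {v : Fin M → ℂ} (hv : U *ᵥ v = -v) (B : Matrix (Fin N) (Fin N) ℂ) :
    DU (outer v ⊗ₖ B) U = 0 := by
  rw [DU, conjA_kronecker, mul_outer_mul_conjTranspose, hv, ← neg_one_smul ℂ v,
    outer_smul _ (by simp), sub_self]
  simp [frob]

/-- For a separable two-qubit state
`ρ = Σ_{i=1}^n p_i |a_i⟩⟨a_i| ⊗ |b_i⟩⟨b_i|`, `D(ρ) ≤ 1 − max_i p_i ≤ 1 − 1/n`. -/
theorem D_separable_le {n : ℕ} (hn : 0 < n)
    (p : Fin n → ℝ) (hp : ∀ i, 0 ≤ p i) (hp1 : ∑ i, p i = 1)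
    (a b : Fin n → Fin 2 → ℂ)
    (ha : ∀ i, dotProduct (star (a i)) (a i) = 1)
    (hb : ∀ i, dotProduct (star (b i)) (b i) = 1) :
    Dm (∑ i, p i • (outer (a i) ⊗ₖ outer (b i))) ≤ 1 - sSup (Set.range p) ∧
    1 - sSup (Set.range p) ≤ 1 - 1 / (n : ℝ) := by
  have : Nonempty (Fin n) := ⟨⟨0, hn⟩⟩
  obtain ⟨m, hm⟩ := exists_eq_ciSup_of_finite (f := p)
  change p m = sSup (Set.range p) at hm
  have hmax : ∀ i, p i ≤ p m := fun i => hm ▸ le_ciSup (Set.finite_range p).bddAbove i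
  rw [← hm]
  constructor
  · obtain ⟨U, hU, hUm⟩ := exists_isRU_mulVec_eq_neg (a m) (ha m)
    refine (Dm_le_DU _ hU).trans ((DU_sum_smul_le _ p hp _ U).trans ?_)
    rw [← hp1, ← Finset.add_sum_erase _ p (Finset.mem_univ m),
      ← Finset.add_sum_erase _ _ (Finset.mem_univ m),
      DU_outer_kronecker_of_mulVec_eq_neg hUm, mul_zero, zero_add, add_sub_cancel_left]
    exact Finset.sum_le_sum fun i _ => mul_le_of_le_one_right (hp i)
      (DU_outer_kronecker_outer_le_one hU.conjTranspose_mul_self _ _ (ha i) (hb i))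
  · have hn' : (0 : ℝ) < n := Nat.cast_pos.mpr hn
    have hsum : 1 ≤ n * p m := by
      simpa [hp1] using Finset.sum_le_sum fun i (_ : i ∈ Finset.univ) => hmax i
    rw [sub_le_sub_iff_left, div_le_iff₀' hn']
    exact hsum

end
end
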